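/- arXiv:2410.16530 — 9 statements merged into one kernel-verified Lean document; each statement's English description precedes it below -/
import Mathlib

section
/- Let f : ℤ × ℤ × ℤ → ℝ have finite support and satisfy Σ_{(i,j,k)} f(i,j,k) = 0. Then there exist finitely supported functions Γ₁, Γ₂, Γ₃ : ℤ × ℤ × ℤ → ℝ such that for every (i,j,k): f(i,j,k) = (Γ₁(i,j,k) − Γ₁(i−1,j,k)) + (Γ₂(i,j,k) − Γ₂(i,j−1,k)) + (Γ₃(i,j,k) − Γ₃(i,j,k−1)). -/
/-- Finitely supported fields that are discrete divergences of finitely supported fluxes. -/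
def fluxDiv : AddSubgroup (ℤ × ℤ × ℤ →₀ ℝ) where
  carrier := {g | ∃ A B C : ℤ × ℤ × ℤ →₀ ℝ, ∀ i j k : ℤ,
    g (i, j, k) = (A (i, j, k) - A (i - 1, j, k)) + (B (i, j, k) - B (i, j - 1, k))
      + (C (i, j, k) - C (i, j, k - 1))}
  zero_mem' := ⟨0, 0, 0, by simp⟩
  add_mem' := by
    rintro g h ⟨A, B, C, H⟩ ⟨A', B', C', H'⟩
    refine ⟨A + A', B + B', C + C', fun i j k => ?_⟩
    simp only [Finsupp.add_apply, H, H']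
    ring
  neg_mem' := by
    rintro g ⟨A, B, C, H⟩
    refine ⟨-A, -B, -C, fun i j k => ?_⟩
    simp only [Finsupp.neg_apply, H]
    ring

lemma fluxDiv_step1 (i j k : ℤ) (a : ℝ) :
    Finsupp.single (i + 1, j, k) a - Finsupp.single (i, j, k) a ∈ fluxDiv := by
  refine ⟨-Finsupp.single (i, j, k) a, 0, 0, fun x y z => ?_⟩
  simp only [Finsupp.sub_apply, Finsupp.neg_apply, Finsupp.single_apply, Prod.mk.injEq,
    Finsupp.coe_zero, Pi.zero_apply, eq_sub_iff_add_eq]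
  ring

lemma fluxDiv_step2 (i j k : ℤ) (a : ℝ) :
    Finsupp.single (i, j + 1, k) a - Finsupp.single (i, j, k) a ∈ fluxDiv := by
  refine ⟨0, -Finsupp.single (i, j, k) a, 0, fun x y z => ?_⟩
  simp only [Finsupp.sub_apply, Finsupp.neg_apply, Finsupp.single_apply, Prod.mk.injEq,
    Finsupp.coe_zero, Pi.zero_apply, eq_sub_iff_add_eq]
  ring

lemma fluxDiv_step3 (i j k : ℤ) (a : ℝ) :
    Finsupp.single (i, j, k + 1) a - Finsupp.single (i, j, k) a ∈ fluxDiv := by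
  refine ⟨0, 0, -Finsupp.single (i, j, k) a, fun x y z => ?_⟩
  simp only [Finsupp.sub_apply, Finsupp.neg_apply, Finsupp.single_apply, Prod.mk.injEq,
    Finsupp.coe_zero, Pi.zero_apply, eq_sub_iff_add_eq]
  ring

/-- Telescoping along one coordinate direction. -/
lemma fluxDiv_line (u : ℤ → (ℤ × ℤ × ℤ →₀ ℝ)) (h : ∀ n, u (n + 1) - u n ∈ fluxDiv) (n : ℤ) :
    u n - u 0 ∈ fluxDiv := by
  induction n using Int.induction_on with
  | zero => simpa using fluxDiv.zero_mem
  | succ n ih => simpa using fluxDiv.add_mem (h n) ih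
  | pred n ih =>
    have := fluxDiv.sub_mem ih (h (-n - 1))
    simpa using this

lemma fluxDiv_point (v : ℤ × ℤ × ℤ) (a : ℝ) :
    Finsupp.single v a - Finsupp.single (0, 0, 0) a ∈ fluxDiv := by
  obtain ⟨i, j, k⟩ := v
  have h1 := fluxDiv_line (fun n => Finsupp.single (n, j, k) a)
    (fun n => fluxDiv_step1 n j k a) i
  have h2 := fluxDiv_line (fun n => Finsupp.single (0, n, k) a)
    (fun n => fluxDiv_step2 0 n k a) j
  have h3 := fluxDiv_line (fun n => Finsupp.single (0, 0, n) a)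
    (fun n => fluxDiv_step3 0 0 n a) k
  simpa using fluxDiv.add_mem (fluxDiv.add_mem h1 h2) h3

/-- Three-dimensional discrete flux-representation theorem: a finitely
supported grid function on `ℤ³` summing to zero is an exact discrete
divergence of finitely supported face fluxes `(Γ₁, Γ₂, Γ₃)`. -/
theorem discrete_flux_representation_3d (f : ℤ × ℤ × ℤ → ℝ)
    (hsupp : (Function.support f).Finite)
    (hsum : ∑ᶠ v : ℤ × ℤ × ℤ, f v = 0) :
    ∃ Γ₁ Γ₂ Γ₃ : ℤ × ℤ × ℤ → ℝ,
      (Function.support Γ₁).Finite ∧ (Function.support Γ₂).Finite ∧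
      (Function.support Γ₃).Finite ∧
      ∀ i j k : ℤ,
        f (i, j, k) = (Γ₁ (i, j, k) - Γ₁ (i - 1, j, k))
          + (Γ₂ (i, j, k) - Γ₂ (i, j - 1, k))
          + (Γ₃ (i, j, k) - Γ₃ (i, j, k - 1)) := by
  have key : Finsupp.ofSupportFinite f hsupp ∈ fluxDiv := by
    set F := Finsupp.ofSupportFinite f hsupp with hF
    have h0 : ∑ v ∈ F.support, F v = 0 := by
      rw [← hsum]
      symm
      apply finsum_eq_sum_of_support_subset
      intro v hv
      simpa [hF, Finsupp.ofSupportFinite_coe] using hv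
    have h1 : ∑ v ∈ F.support, (Finsupp.single v (F v) - Finsupp.single (0, 0, 0) (F v))
        ∈ fluxDiv := fluxDiv.sum_mem fun v _ => fluxDiv_point v (F v)
    rw [Finset.sum_sub_distrib, ← Finsupp.single_finsetSum, h0, Finsupp.single_zero,
      sub_zero] at h1
    have h2 : ∑ v ∈ F.support, Finsupp.single v (F v) = F := Finsupp.sum_single F
    rwa [h2] at h1
  obtain ⟨A, B, C, H⟩ := key
  exact ⟨A, B, C, A.finite_support, B.finite_support, C.finite_support, H⟩
end

section
/- Let x ∈ ℝ be such that x ∉ ℤ + 1/2 (i.e., there is no k ∈ ℤ with x = k + 1/2). Then for every real constant c, the sum Σ_{i∈ℤ} [ S₂(x − i) + c · S₂''(x − i) ] has only finitely many nonzero terms and equals 1, where S₂'' denotes the second derivative of S₂ (which exists at every point x − i under the stated hypothesis). In particular Σ_{i∈ℤ} S₂''(x − i) = 0. -/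
/-- Quadratic B-spline. -/
noncomputable def S2 (x : ℝ) : ℝ :=
  if |x| ≤ 1/2 then 3/4 - x^2
  else if |x| ≤ 3/2 then (3/2 - |x|)^2 / 2
  else 0

theorem S2_aux (a b d l u : ℝ) (h : ∀ t ∈ Set.Ioo l u, S2 t = a + b * t + d * t ^ 2)
    (y : ℝ) (hy : y ∈ Set.Ioo l u) : HasDerivAt (deriv S2) (2 * d) y := by
  have h1 : ∀ t ∈ Set.Ioo l u, deriv S2 t = b + 2 * d * t := by
    intro t ht
    have he : S2 =ᶠ[nhds t] fun t => a + b * t + d * t ^ 2 :=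
      Filter.eventuallyEq_of_mem (isOpen_Ioo.mem_nhds ht) h
    have hd : HasDerivAt (fun t : ℝ => a + b * t + d * t ^ 2) (b + 2 * d * t) t := by
      have := (((hasDerivAt_id t).const_mul b).const_add a).add
        (((hasDerivAt_id t).pow 2).const_mul d)
      refine HasDerivAt.congr_deriv this ?_
      simp; ring
    rw [he.deriv_eq, hd.deriv]
  have he : deriv S2 =ᶠ[nhds y] fun t => b + 2 * d * t :=
    Filter.eventuallyEq_of_mem (isOpen_Ioo.mem_nhds hy) h1
  refine HasDerivAt.congr_of_eventuallyEq ?_ he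
  simpa using ((hasDerivAt_id y).const_mul (2 * d)).const_add b

theorem S2_mid (t : ℝ) (h1 : -(1/2) < t) (h2 : t < 1/2) : S2 t = 3/4 - t ^ 2 := by
  have : |t| ≤ 1/2 := abs_le.2 ⟨h1.le, h2.le⟩
  simp only [S2, if_pos this]

theorem S2_right (t : ℝ) (h1 : 1/2 < t) (h2 : t < 3/2) : S2 t = (3/2 - t) ^ 2 / 2 := by
  have h : |t| = t := abs_of_pos (by linarith)
  simp only [S2, h]
  rw [if_neg (by linarith), if_pos h2.le]

theorem S2_left (t : ℝ) (h1 : -(3/2) < t) (h2 : t < -(1/2)) : S2 t = (3/2 + t) ^ 2 / 2 := by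
  have h : |t| = -t := abs_of_neg (by linarith)
  simp only [S2, h]
  rw [if_neg (by linarith), if_pos (by linarith)]
  ring

theorem S2_far (t : ℝ) (h : 3/2 < |t|) : S2 t = 0 := by
  simp only [S2]
  rw [if_neg (by linarith), if_neg (by linarith)]

theorem S2_dd_mid (t : ℝ) (h1 : -(1/2) < t) (h2 : t < 1/2) : HasDerivAt (deriv S2) (-2) t := by
  have := S2_aux (3/4) 0 (-1) (-(1/2)) (1/2)
    (fun t ht => by rw [S2_mid t ht.1 ht.2]; ring) t ⟨h1, h2⟩
  norm_num at this; exact this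

theorem S2_dd_right (t : ℝ) (h1 : 1/2 < t) (h2 : t < 3/2) : HasDerivAt (deriv S2) 1 t := by
  have := S2_aux (9/8) (-(3/2)) (1/2) (1/2) (3/2)
    (fun t ht => by rw [S2_right t ht.1 ht.2]; ring) t ⟨h1, h2⟩
  norm_num at this; exact this

theorem S2_dd_left (t : ℝ) (h1 : -(3/2) < t) (h2 : t < -(1/2)) : HasDerivAt (deriv S2) 1 t := by
  have := S2_aux (9/8) (3/2) (1/2) (-(3/2)) (-(1/2))
    (fun t ht => by rw [S2_left t ht.1 ht.2]; ring) t ⟨h1, h2⟩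
  norm_num at this; exact this

theorem S2_dd_far (t : ℝ) (h : 3/2 < |t|) : HasDerivAt (deriv S2) 0 t := by
  rcases lt_abs.1 h with h | h
  · have := S2_aux 0 0 0 (3/2) (t+1)
      (fun t ht => by rw [S2_far t (lt_abs.2 (Or.inl ht.1))]; ring) t ⟨h, by linarith⟩
    simpa using this
  · have := S2_aux 0 0 0 (t-1) (-(3/2))
      (fun t ht => by rw [S2_far t (lt_abs.2 (Or.inr (by linarith [ht.2])))]; ring) t
      ⟨by linarith, by linarith⟩
    simpa using this

/-- The modified shape function `S̃₂(x − i) = S₂(x − i) + c·S₂''(x − i)` remains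
a partition of unity whenever `x` is not a half-integer (so that the second
derivative exists at every point `x − i`); in particular
`Σ_{i∈ℤ} S₂''(x − i) = 0`. -/
theorem modified_shape_partition_of_unity (x : ℝ)
    (hx : ∀ k : ℤ, x ≠ (k : ℝ) + 1/2) (c : ℝ) :
    (∀ i : ℤ, DifferentiableAt ℝ (deriv S2) (x - i)) ∧
    (Function.support fun i : ℤ => S2 (x - i) + c * deriv (deriv S2) (x - i)).Finite ∧
    (∑ᶠ i : ℤ, (S2 (x - i) + c * deriv (deriv S2) (x - i))) = 1 ∧
    (∑ᶠ i : ℤ, deriv (deriv S2) (x - i)) = 0 := by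
  obtain ⟨n, hn1, hn2⟩ : ∃ n : ℤ, -(1/2) < x - n ∧ x - n < 1/2 := by
    refine ⟨⌊x + 1/2⌋, ?_, ?_⟩
    · have h1 := Int.floor_le (x + 1/2)
      have h2 := hx (⌊x + 1/2⌋ - 1)
      push_cast at h2
      have h3 : x - ⌊x + 1/2⌋ ≠ -(1/2) := fun h => h2 (by linarith)
      exact lt_of_le_of_ne (by linarith) h3.symm
    · linarith [Int.lt_floor_add_one (x + 1/2)]
  have hfar : ∀ i : ℤ, i ∉ ({n - 1, n, n + 1} : Finset ℤ) → 3/2 < |x - i| := by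
    intro i hi
    simp only [Finset.mem_insert, Finset.mem_singleton, not_or] at hi
    have : i ≤ n - 2 ∨ n + 2 ≤ i := by omega
    rcases this with h | h
    · have : (i : ℝ) ≤ n - 2 := by exact_mod_cast h
      exact lt_abs.2 (Or.inl (by linarith))
    · have : (n : ℝ) + 2 ≤ i := by exact_mod_cast h
      exact lt_abs.2 (Or.inr (by linarith))
  have d0 := S2_dd_mid (x - n) hn1 hn2
  have d1 := S2_dd_right (x - (n - 1 : ℤ)) (by push_cast; linarith) (by push_cast; linarith)
  have d2 := S2_dd_left (x - (n + 1 : ℤ)) (by push_cast; linarith) (by push_cast; linarith)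
  have s0 := S2_mid (x - n) hn1 hn2
  have s1 := S2_right (x - (n - 1 : ℤ)) (by push_cast; linarith) (by push_cast; linarith)
  have s2 := S2_left (x - (n + 1 : ℤ)) (by push_cast; linarith) (by push_cast; linarith)
  have hsup : (Function.support fun i : ℤ => S2 (x - i) + c * deriv (deriv S2) (x - i)) ⊆
      (({n - 1, n, n + 1} : Finset ℤ) : Set ℤ) := by
    intro i hi
    by_contra hc
    have hf := hfar i hc
    exact hi (by simp only [S2_far _ hf, (S2_dd_far _ hf).deriv]; ring)
  have hsup2 : (Function.support fun i : ℤ => deriv (deriv S2) (x - i)) ⊆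
      (({n - 1, n, n + 1} : Finset ℤ) : Set ℤ) := by
    intro i hi
    by_contra hc
    exact hi (S2_dd_far _ (hfar i hc)).deriv
  have hm1 : n - 1 ∉ ({n, n + 1} : Finset ℤ) := by simp; omega
  have hm2 : n ∉ ({n + 1} : Finset ℤ) := by simp
  refine ⟨?_, (Finset.finite_toSet _).subset hsup, ?_, ?_⟩
  · intro i
    by_cases hi : i ∈ ({n - 1, n, n + 1} : Finset ℤ)
    · simp only [Finset.mem_insert, Finset.mem_singleton] at hi
      rcases hi with rfl | rfl | rfl
      · exact d1.differentiableAt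
      · exact d0.differentiableAt
      · exact d2.differentiableAt
    · exact (S2_dd_far _ (hfar i hi)).differentiableAt
  · rw [finsum_eq_sum_of_support_subset _ hsup, Finset.sum_insert hm1, Finset.sum_insert hm2,
      Finset.sum_singleton, d0.deriv, d1.deriv, d2.deriv, s0, s1, s2]
    push_cast
    ring
  · rw [finsum_eq_sum_of_support_subset _ hsup2, Finset.sum_insert hm1, Finset.sum_insert hm2,
      Finset.sum_singleton, d0.deriv, d1.deriv, d2.deriv]
    norm_num
end

section
/- Let Δx > 0, let P be a finite set, and for each p ∈ P let q_p, v_p ∈ ℝ and y_p ∈ ℝ. Let E : ℤ → ℝ have finite support. Define the gathered particle field E_p = Σ_{i∈ℤ} E(i) · S₁(i + 1/2 − y_p/Δx) and the scattered face current j(i) = (1/Δx) Σ_{p∈P} q_p v_p S₁(i + 1/2 − y_p/Δx). Then Σ_{p∈P} q_p E_p v_p = Σ_{i∈ℤ} Δx · j(i) · E(i). -/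
/-- Linear B-spline (hat function). -/
noncomputable def S1 (x : ℝ) : ℝ := if |x| ≤ 1 then 1 - |x| else 0

/-- Exact gather/scatter duality (Eq. E.j-result): the total work done by the
field on the particles equals the mesh integral of `j·E`, where the particle
field `E_p` is gathered from the faces and the face current `j` is scattered
from the particles with the same B-spline. -/
theorem gather_scatter_duality {ι : Type*} (P : Finset ι)
    (Δx : ℝ) (hΔx : 0 < Δx) (q v y : ι → ℝ)
    (E : ℤ → ℝ) (hE : (Function.support E).Finite)
    (Ep : ι → ℝ)
    (hEp : ∀ p, Ep p = ∑ᶠ i : ℤ, E i * S1 ((i : ℝ) + 1/2 - y p / Δx))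
    (j : ℤ → ℝ)
    (hj : ∀ i : ℤ, j i = (1/Δx) * ∑ p ∈ P, q p * v p * S1 ((i : ℝ) + 1/2 - y p / Δx)) :
    (∑ p ∈ P, q p * Ep p * v p) = ∑ᶠ i : ℤ, Δx * j i * E i := by
  have h1 : ∀ p, Ep p = ∑ i ∈ hE.toFinset, E i * S1 ((i : ℝ) + 1/2 - y p / Δx) := by
    intro p
    rw [hEp]
    apply finsum_eq_sum_of_support_subset
    intro i hi
    simp only [Function.mem_support, Set.Finite.coe_toFinset] at hi ⊢
    exact left_ne_zero_of_mul hi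
  have h2 : ∑ᶠ i : ℤ, Δx * j i * E i = ∑ i ∈ hE.toFinset, Δx * j i * E i := by
    apply finsum_eq_sum_of_support_subset
    intro i hi
    simp only [Function.mem_support, Set.Finite.coe_toFinset] at hi ⊢
    exact right_ne_zero_of_mul hi
  have h3 : ∀ i, Δx * j i = ∑ p ∈ P, q p * v p * S1 ((i : ℝ) + 1/2 - y p / Δx) := by
    intro i
    rw [hj, ← mul_assoc, mul_one_div_cancel hΔx.ne', one_mul]
  rw [h2]
  simp only [h1, h3, Finset.sum_mul, Finset.mul_sum]
  rw [Finset.sum_comm]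
  refine Finset.sum_congr rfl fun i _ => Finset.sum_congr rfl fun p _ => ?_
  ring
end

section
/- Consider the 1D implicit electrostatic PIC step with no cell crossing. Then for every i ∈ ℤ the fully discrete local kinetic-energy conservation law holds: (e_{k,i}^{n+1} − e_{k,i}^{n})/Δt + (Γ_{i+1/2} − Γ_{i−1/2})/Δx = (1/Δx) Σ_{p∈P} q_p E_p v_p^{1/2} S̃_i(p), where e_{k,i}^{s} = (1/Δx) Σ_{p∈P} (m_p (v_p^{s})²/2) S₂(i − x_p^{s}/Δx) for s ∈ {n, n+1}; e_{k,p}^{1/2} = (m_p/2)·((v_p^{n+1})²/2 + (v_p^{n})²/2); Γ_{i+1/2} = (1/Δx) Σ_{p∈P} S₁(i + 1/2 − x_p^{1/2}/Δx) · v_p^{1/2} · e_{k,p}^{1/2}; and S̃_i(p) = S₂(i − x_p^{1/2}/Δx) + (Δt² (v_p^{1/2})²/(8 Δx²)) · S₂''(i − x_p^{1/2}/Δx), with S₂'' the second derivative of S₂ (which exists at the arguments in question under the no-crossing hypothesis). -/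
theorem S2_local_quadratic (j : ℤ) : ∃ A B C : ℝ, ∀ x : ℝ, (j : ℝ) - 1/2 < x → x < (j : ℝ) + 1/2 →
    S2 x = A * x^2 + B * x + C ∧ S1 (x + 1/2) - S1 (x - 1/2) = 2 * A * x + B := by
  have hj : j ≤ -2 ∨ j = -1 ∨ j = 0 ∨ j = 1 ∨ 2 ≤ j := by omega
  rcases hj with hj | rfl | rfl | rfl | hj
  · have hj' : (j : ℝ) ≤ -2 := by exact_mod_cast hj
    refine ⟨0, 0, 0, fun x h1 h2 => ?_⟩
    have e1 : |x| = -x := abs_of_neg (by linarith)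
    have e2 : |x + 1/2| = -(x + 1/2) := abs_of_neg (by linarith)
    have e3 : |x - 1/2| = -(x - 1/2) := abs_of_neg (by linarith)
    unfold S1 S2
    rw [e1, e2, e3, if_neg (by linarith), if_neg (by linarith), if_neg (by linarith),
      if_neg (by linarith)]
    constructor <;> ring
  · refine ⟨1/2, 3/2, 9/8, fun x h1 h2 => ?_⟩
    push_cast at h1 h2
    have e1 : |x| = -x := abs_of_neg (by linarith)
    have e2 : |x + 1/2| = -(x + 1/2) := abs_of_neg (by linarith)
    have e3 : |x - 1/2| = -(x - 1/2) := abs_of_neg (by linarith)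
    unfold S1 S2
    rw [e1, e2, e3, if_neg (by linarith), if_pos (by linarith), if_pos (by linarith),
      if_neg (by linarith)]
    constructor <;> ring
  · refine ⟨-1, 0, 3/4, fun x h1 h2 => ?_⟩
    push_cast at h1 h2
    have e1 : |x| ≤ 1/2 := abs_le.2 ⟨by linarith, by linarith⟩
    have e2 : |x + 1/2| = (x + 1/2) := abs_of_pos (by linarith)
    have e3 : |x - 1/2| = -(x - 1/2) := abs_of_neg (by linarith)
    unfold S1 S2
    rw [e2, e3, if_pos e1, if_pos (by linarith), if_pos (by linarith)]
    constructor <;> ring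
  · refine ⟨1/2, -3/2, 9/8, fun x h1 h2 => ?_⟩
    push_cast at h1 h2
    have e1 : |x| = x := abs_of_pos (by linarith)
    have e2 : |x + 1/2| = (x + 1/2) := abs_of_pos (by linarith)
    have e3 : |x - 1/2| = (x - 1/2) := abs_of_pos (by linarith)
    unfold S1 S2
    rw [e1, e2, e3, if_neg (by linarith), if_pos (by linarith), if_neg (by linarith),
      if_pos (by linarith)]
    constructor <;> ring
  · have hj' : (2 : ℝ) ≤ j := by exact_mod_cast hj
    refine ⟨0, 0, 0, fun x h1 h2 => ?_⟩
    have e1 : |x| = x := abs_of_pos (by linarith)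
    have e2 : |x + 1/2| = (x + 1/2) := abs_of_pos (by linarith)
    have e3 : |x - 1/2| = (x - 1/2) := abs_of_pos (by linarith)
    unfold S1 S2
    rw [e1, e2, e3, if_neg (by linarith), if_neg (by linarith), if_neg (by linarith),
      if_neg (by linarith)]
    constructor <;> ring

theorem deriv2_of_local_quadratic (f : ℝ → ℝ) (l u A B C : ℝ)
    (hf : ∀ x, l < x → x < u → f x = A * x^2 + B * x + C) (c : ℝ) (h1 : l < c) (h2 : c < u) :
    deriv (deriv f) c = 2 * A := by
  have key : ∀ x, l < x → x < u → deriv f x = 2 * A * x + B := by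
    intro x hx1 hx2
    have hev : f =ᶠ[nhds x] fun y => A * y^2 + B * y + C := by
      filter_upwards [Ioo_mem_nhds hx1 hx2] with y hy using hf y hy.1 hy.2
    rw [hev.deriv_eq]
    have h := ((((hasDerivAt_id x).pow 2).const_mul A).add
      ((hasDerivAt_id x).const_mul B)).add_const C
    have h' : HasDerivAt (fun y : ℝ => A * y^2 + B * y + C) (2 * A * x + B) x := by
      refine HasDerivAt.congr_deriv h ?_
      simp
      ring
    exact h'.deriv
  have hev : deriv f =ᶠ[nhds c] fun y => 2 * A * y + B := by
    filter_upwards [Ioo_mem_nhds h1 h2] with y hy using key y hy.1 hy.2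
  rw [hev.deriv_eq]
  have h := ((hasDerivAt_id c).const_mul (2 * A)).add_const B
  have h' : HasDerivAt (fun y : ℝ => 2 * A * y + B) (2 * A) c := by
    refine HasDerivAt.congr_deriv h ?_
    simp
  exact h'.deriv

/-- Fully discrete local kinetic-energy conservation law for the 1D implicit
electrostatic PIC step with no cell crossing (Eq. cons-e_k-final):
`(e_{k,i}^{n+1} − e_{k,i}^{n})/Δt + (Γ_{i+1/2} − Γ_{i−1/2})/Δx
  = (1/Δx) Σ_p q_p E_p v_p^{1/2} S̃_i(p)`. -/
theorem local_kinetic_energy_conservation {ι : Type*} (P : Finset ι)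
    (Δt Δx : ℝ) (hΔt : 0 < Δt) (hΔx : 0 < Δx)
    (m q xn xn1 vn vn1 : ι → ℝ)
    (E : ℤ → ℝ) (hE : (Function.support E).Finite)
    (xh : ι → ℝ) (hxh : ∀ p, xh p = (xn p + xn1 p) / 2)
    (vh : ι → ℝ) (hvh : ∀ p, vh p = (vn p + vn1 p) / 2)
    (Ep : ι → ℝ)
    (hEp : ∀ p, Ep p = ∑ᶠ i : ℤ, E i * S1 ((i : ℝ) + 1/2 - xh p / Δx))
    (hpush : ∀ p ∈ P, xn1 p - xn p = Δt * vh p)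
    (haccel : ∀ p ∈ P, m p * (vn1 p - vn p) = Δt * q p * Ep p)
    (hnocross : ∀ p ∈ P, ∃ k : ℤ,
      ((k : ℝ) - 1/2) * Δx < xn p ∧ xn p < ((k : ℝ) + 1/2) * Δx ∧
      ((k : ℝ) - 1/2) * Δx < xn1 p ∧ xn1 p < ((k : ℝ) + 1/2) * Δx) :
    ∀ i : ℤ,
      ((1/Δx) * (∑ p ∈ P, (m p * (vn1 p)^2 / 2) * S2 ((i : ℝ) - xn1 p / Δx))
        - (1/Δx) * (∑ p ∈ P, (m p * (vn p)^2 / 2) * S2 ((i : ℝ) - xn p / Δx))) / Δt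
      + ((1/Δx) * (∑ p ∈ P, S1 ((i : ℝ) + 1/2 - xh p / Δx) * vh p *
            ((m p / 2) * ((vn1 p)^2 / 2 + (vn p)^2 / 2)))
        - (1/Δx) * (∑ p ∈ P, S1 (((i : ℝ) - 1) + 1/2 - xh p / Δx) * vh p *
            ((m p / 2) * ((vn1 p)^2 / 2 + (vn p)^2 / 2)))) / Δx
      = (1/Δx) * ∑ p ∈ P, q p * Ep p * vh p *
          (S2 ((i : ℝ) - xh p / Δx)
            + (Δt^2 * (vh p)^2 / (8 * Δx^2)) * deriv (deriv S2) ((i : ℝ) - xh p / Δx)) := by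
  intro i
  have hx0 : Δx ≠ 0 := hΔx.ne'
  have ht0 : Δt ≠ 0 := hΔt.ne'
  rw [← mul_sub, ← mul_sub, ← Finset.sum_sub_distrib, ← Finset.sum_sub_distrib, mul_div_assoc,
    mul_div_assoc, ← mul_add, Finset.sum_div, Finset.sum_div, ← Finset.sum_add_distrib]
  congr 1
  refine Finset.sum_congr rfl fun p hp => ?_
  obtain ⟨k, k1, k2, k3, k4⟩ := hnocross p hp
  obtain ⟨A, B, C, hq⟩ := S2_local_quadratic (i - k)
  push_cast at hq
  have g1 : (k : ℝ) - 1/2 < xn p / Δx := (lt_div_iff₀ hΔx).2 k1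
  have g2 : xn p / Δx < (k : ℝ) + 1/2 := (div_lt_iff₀ hΔx).2 k2
  have g3 : (k : ℝ) - 1/2 < xn1 p / Δx := (lt_div_iff₀ hΔx).2 k3
  have g4 : xn1 p / Δx < (k : ℝ) + 1/2 := (div_lt_iff₀ hΔx).2 k4
  have hmid : xh p / Δx = (xn p / Δx + xn1 p / Δx) / 2 := by rw [hxh p]; ring
  have hd : xn1 p / Δx - xn p / Δx = Δt * vh p / Δx := by rw [← hpush p hp]; ring
  have c1 : (i : ℝ) - k - 1/2 < i - xh p / Δx := by linarith
  have c2 : (i : ℝ) - xh p / Δx < i - k + 1/2 := by linarith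
  have q0 := (hq (i - xn p / Δx) (by linarith) (by linarith)).1
  have q1 := (hq (i - xn1 p / Δx) (by linarith) (by linarith)).1
  obtain ⟨qc, qd⟩ := hq (i - xh p / Δx) c1 c2
  have qdd := deriv2_of_local_quadratic S2 _ _ A B C (fun x a b => (hq x a b).1) _ c1 c2
  have r1 : (i : ℝ) + 1/2 - xh p / Δx = i - xh p / Δx + 1/2 := by ring
  have r2 : (i : ℝ) - 1 + 1/2 - xh p / Δx = i - xh p / Δx - 1/2 := by ring
  rw [r1, r2, q0, q1, qc, qdd]
  have qd' := eq_add_of_sub_eq qd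
  rw [qd']
  generalize S1 (i - xh p / Δx - 1/2) = s
  have hqE : q p * Ep p = m p * (vn1 p - vn p) / Δt := by
    rw [haccel p hp]; field_simp
  have hs : xn p / Δx = xh p / Δx - Δt * vh p / Δx / 2 := by linarith
  have hs1 : xn1 p / Δx = xh p / Δx + Δt * vh p / Δx / 2 := by linarith
  rw [hqE, hs, hs1, hvh p]
  field_simp
  ring
end

section
/- Consider the full 1D implicit electrostatic PIC scheme (particle push with gather from the time-centered field, plus the discrete Ampere update with zero average current). Then total energy is conserved exactly: Σ_{p∈P} m_p (v_p^{n+1})²/2 + (Δx/2) Σ_{i∈ℤ} (E^{n+1}(i))² = Σ_{p∈P} m_p (v_p^{n})²/2 + (Δx/2) Σ_{i∈ℤ} (E^{n}(i))². -/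
/-- Exact global total-energy conservation of the full 1D implicit
electrostatic PIC scheme (particle push gathered from the time-centered field,
plus the discrete Ampere update with zero average current). -/
theorem global_energy_conservation {ι : Type*} (P : Finset ι)
    (Δt Δx : ℝ) (hΔt : 0 < Δt) (hΔx : 0 < Δx)
    (m q xn xn1 vn vn1 : ι → ℝ)
    (En En1 : ℤ → ℝ)
    (hEn : (Function.support En).Finite) (hEn1 : (Function.support En1).Finite)
    (Eh : ℤ → ℝ) (hEh : ∀ i, Eh i = (En i + En1 i) / 2)
    (xh : ι → ℝ) (hxh : ∀ p, xh p = (xn p + xn1 p) / 2)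
    (vh : ι → ℝ) (hvh : ∀ p, vh p = (vn p + vn1 p) / 2)
    (Ep : ι → ℝ)
    (hEp : ∀ p, Ep p = ∑ᶠ i : ℤ, Eh i * S1 ((i : ℝ) + 1/2 - xh p / Δx))
    (hpush : ∀ p ∈ P, xn1 p - xn p = Δt * vh p)
    (haccel : ∀ p ∈ P, m p * (vn1 p - vn p) = Δt * q p * Ep p)
    (j : ℤ → ℝ)
    (hj : ∀ i : ℤ, j i = (1/Δx) * ∑ p ∈ P, q p * vh p * S1 ((i : ℝ) + 1/2 - xh p / Δx))
    (hampere : ∀ i : ℤ, (En1 i - En i) / Δt + j i = 0) :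
    (∑ p ∈ P, m p * (vn1 p)^2 / 2) + (Δx / 2) * (∑ᶠ i : ℤ, (En1 i)^2)
      = (∑ p ∈ P, m p * (vn p)^2 / 2) + (Δx / 2) * (∑ᶠ i : ℤ, (En i)^2) := by
  classical
  set T : Finset ℤ := hEn.toFinset ∪ hEn1.toFinset with hT
  have h0 : ∀ i, i ∉ T → En i = 0 ∧ En1 i = 0 := by
    intro i hi
    simpa [hT, not_or] using hi
  have hfs : ∀ f : ℤ → ℝ, (∀ i, i ∉ T → f i = 0) → ∑ᶠ i, f i = ∑ i ∈ T, f i := by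
    intro f hf
    apply finsum_eq_sum_of_support_subset
    intro i hi
    by_contra hc
    exact hi (hf i hc)
  rw [hfs (fun i => (En1 i)^2) (fun i hi => by simp [(h0 i hi).2]),
    hfs (fun i => (En i)^2) (fun i hi => by simp [(h0 i hi).1])]
  have hEp' : ∀ p, Ep p = ∑ i ∈ T, Eh i * S1 ((i : ℝ) + 1/2 - xh p / Δx) := by
    intro p
    rw [hEp p]
    exact hfs _ (fun i hi => by simp [hEh, (h0 i hi).1, (h0 i hi).2])
  have hK : (∑ p ∈ P, m p * (vn1 p)^2 / 2) - (∑ p ∈ P, m p * (vn p)^2 / 2)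
      = ∑ p ∈ P, ∑ i ∈ T, Δt * q p * vh p * (Eh i * S1 ((i : ℝ) + 1/2 - xh p / Δx)) := by
    rw [← Finset.sum_sub_distrib]
    refine Finset.sum_congr rfl fun p hp => ?_
    rw [← Finset.mul_sum, ← hEp' p]
    have h1 := haccel p hp
    have h2 := hvh p
    rw [h2]
    linear_combination (vn p + vn1 p) / 2 * h1
  have hF : (Δx / 2) * (∑ i ∈ T, (En1 i)^2) - (Δx / 2) * (∑ i ∈ T, (En i)^2)
      = - ∑ i ∈ T, ∑ p ∈ P, Δt * q p * vh p * (Eh i * S1 ((i : ℝ) + 1/2 - xh p / Δx)) := by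
    rw [← mul_sub, ← Finset.sum_sub_distrib, Finset.mul_sum, ← Finset.sum_neg_distrib]
    refine Finset.sum_congr rfl fun i _ => ?_
    have h1 : ∑ p ∈ P, Δt * q p * vh p * (Eh i * S1 ((i : ℝ) + 1/2 - xh p / Δx))
        = Δt * Eh i * ∑ p ∈ P, q p * vh p * S1 ((i : ℝ) + 1/2 - xh p / Δx) := by
      rw [Finset.mul_sum]
      exact Finset.sum_congr rfl fun p _ => by ring
    have h2 := hampere i
    rw [hj i] at h2
    rw [h1, hEh i]
    generalize ∑ p ∈ P, q p * vh p * S1 ((i : ℝ) + 1/2 - xh p / Δx) = J at h2 ⊢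
    field_simp at h2
    linear_combination (En i + En1 i) / 2 * h2
  rw [Finset.sum_comm] at hF
  linarith
end

section
/- Consider the full 1D implicit electrostatic PIC scheme (particle push with gather from the time-centered field, discrete Ampere update with zero average current) with no cell crossing. Then a fully discrete local total-energy conservation theorem holds: there exists a finitely supported numerical flux Γ_K : ℤ → ℝ such that for every i ∈ ℤ, (e_{k,i}^{n+1} − e_{k,i}^{n})/Δt + (ℰ_i^{n+1} − ℰ_i^{n})/Δt + (Γ_{i+1/2} − Γ_{i−1/2})/Δx = (Γ_K(i) − Γ_K(i−1))/Δx, where e_{k,i}^{s} = (1/Δx) Σ_{p∈P} (m_p (v_p^{s})²/2) S₂(i − x_p^{s}/Δx) and ℰ_i^{s} = ((E^{s}(i))² + (E^{s}(i−1))²)/4 for s ∈ {n, n+1}, and Γ_{i+1/2} = (1/Δx) Σ_{p∈P} S₁(i + 1/2 − x_p^{1/2}/Δx) · v_p^{1/2} · (m_p/2)·((v_p^{n+1})²/2 + (v_p^{n})²/2). -/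
/-- Finitely supported with total sum `a`. -/
def FS (f : ℤ → ℝ) (a : ℝ) : Prop := (Function.support f).Finite ∧ HasSum f a

lemma FS.of_finite {f : ℤ → ℝ} (h : (Function.support f).Finite) : FS f (∑ᶠ i, f i) := by
  refine ⟨h, ?_⟩
  rw [finsum_eq_sum f h]
  apply hasSum_sum_of_ne_finset_zero
  intro b hb
  simpa using hb

lemma FS.add {f g : ℤ → ℝ} {a b : ℝ} (hf : FS f a) (hg : FS g b) :
    FS (fun i => f i + g i) (a + b) :=
  ⟨(hf.1.union hg.1).subset (Function.support_add f g), hf.2.add hg.2⟩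

lemma FS.sub {f g : ℤ → ℝ} {a b : ℝ} (hf : FS f a) (hg : FS g b) :
    FS (fun i => f i - g i) (a - b) :=
  ⟨(hf.1.union hg.1).subset (Function.support_sub f g), hf.2.sub hg.2⟩

lemma FS.mul {f : ℤ → ℝ} {a : ℝ} (c : ℝ) (hf : FS f a) :
    FS (fun i => c * f i) (c * a) :=
  ⟨hf.1.subset (fun i hi h0 => hi (by simp [h0])), hf.2.mul_left c⟩

lemma FS.sum {ι : Type*} (P : Finset ι) {f : ι → ℤ → ℝ} {a : ι → ℝ}
    (hf : ∀ p ∈ P, FS (f p) (a p)) :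
    FS (fun i => ∑ p ∈ P, f p i) (∑ p ∈ P, a p) := by
  refine ⟨?_, hasSum_sum (fun p hp => (hf p hp).2)⟩
  refine (Set.Finite.biUnion P.finite_toSet (fun p hp => (hf p hp).1)).subset ?_
  intro i hi
  by_contra h
  simp only [Set.mem_iUnion, not_exists, Function.mem_support, not_not] at h
  exact hi (Finset.sum_eq_zero (fun p hp => h p hp))

lemma FS.shift {f : ℤ → ℝ} {a : ℝ} (hf : FS f a) : FS (fun i => f (i - 1)) a := by
  refine ⟨?_, (Equiv.subRight (1 : ℤ)).hasSum_iff.mpr hf.2⟩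
  exact hf.1.preimage (f := fun i : ℤ => i - 1) ((Equiv.subRight (1 : ℤ)).injective.injOn)

lemma FS.flux {f : ℤ → ℝ} (hf : FS f 0) :
    ∃ g : ℤ → ℝ, (Function.support g).Finite ∧ ∀ i, f i = g i - g (i - 1) := by
  obtain ⟨h1, h2⟩ := hf
  have htot : ∑ k ∈ h1.toFinset, f k = 0 := by
    rw [← finsum_eq_sum f h1]; exact (FS.of_finite h1).2.unique h2
  refine ⟨fun i => ∑ k ∈ h1.toFinset, if k ≤ i then f k else 0, ?_, ?_⟩
  · obtain ⟨u, hu⟩ := h1.bddAbove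
    obtain ⟨l, hl⟩ := h1.bddBelow
    refine (Set.finite_Icc l u).subset ?_
    intro i hi
    by_contra hc
    apply hi
    simp only [Set.mem_Icc, not_and_or, not_le] at hc
    rcases hc with hc | hc
    · apply Finset.sum_eq_zero
      intro k hk
      have := hl (h1.mem_toFinset.mp hk)
      rw [if_neg (by omega)]
    · rw [← htot]
      apply Finset.sum_congr rfl
      intro k hk
      have := hu (h1.mem_toFinset.mp hk)
      rw [if_pos (by omega)]
  · intro i
    simp only
    rw [← Finset.sum_sub_distrib]
    have : ∀ k ∈ h1.toFinset, ((if k ≤ i then f k else 0) - (if k ≤ i - 1 then f k else 0))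
        = if i = k then f k else 0 := by
      intro k _
      split_ifs <;> first | omega | simp
    rw [Finset.sum_congr rfl this, Finset.sum_ite_eq]
    split_ifs with h
    · rfl
    · simpa using h

lemma S1_fin (c : ℝ) : (Function.support (fun i : ℤ => S1 ((i : ℝ) + 1/2 - c))).Finite := by
  refine (Set.finite_Icc (⌊c - 2⌋) (⌈c + 2⌉)).subset ?_
  intro i hi
  have h : |(i : ℝ) + 1/2 - c| ≤ 1 := by
    by_contra h
    exact hi (by simp only [S1]; rw [if_neg h])
  rw [abs_le] at h
  have h1 := Int.floor_le (c - 2)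
  have h2 := Int.le_ceil (c + 2)
  constructor
  · have : (⌊c - 2⌋ : ℝ) ≤ i := by linarith
    exact_mod_cast this
  · have : (i : ℝ) ≤ (⌈c + 2⌉ : ℝ) := by linarith
    exact_mod_cast this

lemma S2_FS (c : ℝ) : FS (fun i : ℤ => S2 ((i : ℝ) - c)) 1 := by
  obtain ⟨k, hk1, hk2⟩ : ∃ k : ℤ, (k : ℝ) - 1/2 ≤ c ∧ c < k + 1/2 := by
    refine ⟨⌊c + 1/2⌋, ?_, ?_⟩
    · have := Int.floor_le (c + 1/2); linarith
    · have := Int.lt_floor_add_one (c + 1/2); linarith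
  have hz : ∀ i ∉ ({k - 1, k, k + 1} : Finset ℤ), S2 ((i : ℝ) - c) = 0 := by
    intro i hi
    simp only [Finset.mem_insert, Finset.mem_singleton, not_or] at hi
    have h3 : 3/2 ≤ |(i : ℝ) - c| := by
      rcases lt_or_ge i k with h | h
      · have : i ≤ k - 2 := by omega
        have : (i : ℝ) ≤ k - 2 := by exact_mod_cast this
        rw [le_abs]; right; linarith
      · have : k + 2 ≤ i := by omega
        have : (k : ℝ) + 2 ≤ i := by exact_mod_cast this
        rw [le_abs]; left; linarith
    unfold S2
    rw [if_neg (by linarith)]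
    split_ifs with h4
    · have : |(i : ℝ) - c| = 3/2 := le_antisymm h4 h3
      rw [this]; norm_num
    · rfl
  have hs : ∑ i ∈ ({k - 1, k, k + 1} : Finset ℤ), S2 ((i : ℝ) - c) = 1 := by
    rw [Finset.sum_insert (by simp; omega), Finset.sum_insert (by simp), Finset.sum_singleton]
    have e1 : S2 (((k - 1 : ℤ) : ℝ) - c) = (3/2 - (c - k + 1))^2 / 2 := by
      push_cast
      have : |(k : ℝ) - 1 - c| = c - k + 1 := by
        rw [abs_of_nonpos (by linarith)]; ring
      unfold S2
      rw [this]
      split_ifs with h1 h2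
      · have : c = k - 1/2 := by linarith
        rw [this]; ring
      · rfl
      · linarith
    have e2 : S2 ((k : ℝ) - c) = 3/4 - (k - c)^2 := by
      unfold S2
      rw [if_pos (by rw [abs_le]; constructor <;> linarith)]
    have e3 : S2 (((k + 1 : ℤ) : ℝ) - c) = (3/2 - (k + 1 - c))^2 / 2 := by
      push_cast
      have : |(k : ℝ) + 1 - c| = k + 1 - c := abs_of_nonneg (by linarith)
      unfold S2
      rw [this]
      split_ifs with h1 h2
      · linarith
      · rfl
      · linarith
    rw [e1, e2, e3]; ring
  refine ⟨?_, ?_⟩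
  · refine (Finset.finite_toSet ({k - 1, k, k + 1} : Finset ℤ)).subset ?_
    intro i hi
    by_contra h
    exact hi (hz i h)
  · rw [← hs]; exact hasSum_sum_of_ne_finset_zero hz

/-- Fully discrete local total-energy conservation theorem for the full 1D
implicit electrostatic PIC scheme with no cell crossing: there is a finitely
supported numerical flux `Γ_K` such that for every cell `i`,
`(e_{k,i}^{n+1} − e_{k,i}^{n})/Δt + (ℰ_i^{n+1} − ℰ_i^{n})/Δt
  + (Γ_{i+1/2} − Γ_{i−1/2})/Δx = (Γ_K(i) − Γ_K(i−1))/Δx`. -/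
theorem local_total_energy_conservation {ι : Type*} (P : Finset ι)
    (Δt Δx : ℝ) (hΔt : 0 < Δt) (hΔx : 0 < Δx)
    (m q xn xn1 vn vn1 : ι → ℝ)
    (En En1 : ℤ → ℝ)
    (hEn : (Function.support En).Finite) (hEn1 : (Function.support En1).Finite)
    (Eh : ℤ → ℝ) (hEh : ∀ i, Eh i = (En i + En1 i) / 2)
    (xh : ι → ℝ) (hxh : ∀ p, xh p = (xn p + xn1 p) / 2)
    (vh : ι → ℝ) (hvh : ∀ p, vh p = (vn p + vn1 p) / 2)
    (Ep : ι → ℝ)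
    (hEp : ∀ p, Ep p = ∑ᶠ i : ℤ, Eh i * S1 ((i : ℝ) + 1/2 - xh p / Δx))
    (hpush : ∀ p ∈ P, xn1 p - xn p = Δt * vh p)
    (haccel : ∀ p ∈ P, m p * (vn1 p - vn p) = Δt * q p * Ep p)
    (j : ℤ → ℝ)
    (hj : ∀ i : ℤ, j i = (1/Δx) * ∑ p ∈ P, q p * vh p * S1 ((i : ℝ) + 1/2 - xh p / Δx))
    (hampere : ∀ i : ℤ, (En1 i - En i) / Δt + j i = 0)
    (hnocross : ∀ p ∈ P, ∃ k : ℤ,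
      ((k : ℝ) - 1/2) * Δx < xn p ∧ xn p < ((k : ℝ) + 1/2) * Δx ∧
      ((k : ℝ) - 1/2) * Δx < xn1 p ∧ xn1 p < ((k : ℝ) + 1/2) * Δx) :
    ∃ ΓK : ℤ → ℝ, (Function.support ΓK).Finite ∧
      ∀ i : ℤ,
        ((1/Δx) * (∑ p ∈ P, (m p * (vn1 p)^2 / 2) * S2 ((i : ℝ) - xn1 p / Δx))
          - (1/Δx) * (∑ p ∈ P, (m p * (vn p)^2 / 2) * S2 ((i : ℝ) - xn p / Δx))) / Δt
        + (((En1 i)^2 + (En1 (i - 1))^2) / 4 - ((En i)^2 + (En (i - 1))^2) / 4) / Δt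
        + ((1/Δx) * (∑ p ∈ P, S1 ((i : ℝ) + 1/2 - xh p / Δx) * vh p *
              ((m p / 2) * ((vn1 p)^2 / 2 + (vn p)^2 / 2)))
          - (1/Δx) * (∑ p ∈ P, S1 (((i : ℝ) - 1) + 1/2 - xh p / Δx) * vh p *
              ((m p / 2) * ((vn1 p)^2 / 2 + (vn p)^2 / 2)))) / Δx
        = (ΓK i - ΓK (i - 1)) / Δx := by
  have hS2 : ∀ (w x : ι → ℝ), FS (fun i : ℤ => (1/Δx) * ∑ p ∈ P, w p * S2 ((i : ℝ) - x p / Δx))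
      ((1/Δx) * ∑ p ∈ P, w p * 1) := fun w x =>
    (FS.sum P (fun p _ => (S2_FS (x p / Δx)).mul (w p))).mul (1/Δx)
  have hG := (FS.sum P (fun p _ => (FS.of_finite (S1_fin (xh p / Δx))).mul
    (vh p * ((m p / 2) * ((vn1 p)^2 / 2 + (vn p)^2 / 2))))).mul (1/Δx)
  have hEhf : ∀ p, (Function.support
      (fun i : ℤ => Eh i * S1 ((i : ℝ) + 1/2 - xh p / Δx))).Finite := fun p =>
    (S1_fin (xh p / Δx)).subset (fun i hi h0 => hi (by
      simp only at h0 ⊢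
      rw [h0, mul_zero]))
  have hA := (FS.sum P (fun p _ => (FS.of_finite (hEhf p)).mul (q p * vh p))).mul (-(1/Δx)/2)
  have hA' : ∀ i : ℤ, ((En1 i)^2 - (En i)^2) / 4 / Δt = (-(1/Δx)/2) *
      ∑ p ∈ P, q p * vh p * (Eh i * S1 ((i : ℝ) + 1/2 - xh p / Δx)) := by
    intro i
    have h1 : (En1 i - En i) / Δt = - j i := by linarith [hampere i]
    have h2 : ∑ p ∈ P, q p * vh p * (Eh i * S1 ((i : ℝ) + 1/2 - xh p / Δx))
        = Eh i * ∑ p ∈ P, q p * vh p * S1 ((i : ℝ) + 1/2 - xh p / Δx) := by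
      rw [Finset.mul_sum]
      exact Finset.sum_congr rfl (fun p _ => by ring)
    have h3 : ((En1 i)^2 - (En i)^2) / 4 / Δt = (En1 i - En i) / Δt * (Eh i / 2) := by
      rw [hEh]; ring
    rw [h3, h1, hj, h2]; ring
  have hall := (((((hS2 (fun p => m p * (vn1 p)^2 / 2) xn1).sub
    (hS2 (fun p => m p * (vn p)^2 / 2) xn)).mul (1/Δt)).add (hA.add hA.shift)).add
    ((hG.sub hG.shift).mul (1/Δx))).mul Δx
  have hzero : ∀ p ∈ P, (1/Δt) * (m p * (vn1 p)^2 / 2 - m p * (vn p)^2 / 2)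
      = q p * vh p * Ep p := by
    intro p hp
    have h := haccel p hp
    have : m p * (vn1 p)^2 / 2 - m p * (vn p)^2 / 2 = m p * (vn1 p - vn p) * vh p := by
      rw [hvh]; ring
    rw [this, h]; field_simp
  have hzero' := Finset.sum_congr rfl hzero
  rw [← Finset.mul_sum, Finset.sum_sub_distrib] at hzero'
  obtain ⟨g, hg1, hg2⟩ := FS.flux (by
    convert hall using 1
    simp only [← hEp, mul_one]
    rw [← hzero']
    ring)
  refine ⟨g, hg1, fun i => ?_⟩
  rw [← hg2 i]
  simp only [← hA']
  have hc : ∀ (a : ℤ), ∑ p ∈ P, S1 ((a : ℝ) + 1/2 - xh p / Δx) * vh p *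
              ((m p / 2) * ((vn1 p)^2 / 2 + (vn p)^2 / 2)) =
      ∑ p ∈ P, vh p * ((m p / 2) * ((vn1 p)^2 / 2 + (vn p)^2 / 2)) *
        S1 ((a : ℝ) + 1/2 - xh p / Δx) := fun a =>
    Finset.sum_congr rfl (fun p _ => by ring)
  have hc1 := hc (i - 1)
  rw [hc i]
  rw [Int.cast_sub, Int.cast_one] at hc1
  rw [hc1]
  simp only [Int.cast_sub, Int.cast_one]
  field_simp
  ring
end

section
/- Fix Δt, Δx, Δy, Δz > 0 and functions φⁿ, φⁿ⁺¹ : ℤ³ → ℝ and face currents jx, jy, jz : ℤ³ → ℝ. Define the face electric fields Exˢ(i,j,k) = −(φˢ(i+1,j,k) − φˢ(i,j,k))/Δx, Eyˢ(i,j,k) = −(φˢ(i,j+1,k) − φˢ(i,j,k))/Δy, Ezˢ(i,j,k) = −(φˢ(i,j,k+1) − φˢ(i,j,k))/Δz for s ∈ {n, n+1}, the time-centered values Xⁿ⁺¹ᐟ² = (Xⁿ + Xⁿ⁺¹)/2, and suppose the discrete Ampere divergence law holds at every (i,j,k): [(Exⁿ⁺¹ − Exⁿ)/Δt + jx](i,j,k)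 − [(Exⁿ⁺¹ − Exⁿ)/Δt + jx](i−1,j,k) all divided by Δx, plus the analogous y and z differences divided by Δy and Δz, equals 0. Define the cell field energy ℰˢ(i,j,k) = [Exˢ(i,j,k)² + Exˢ(i−1,j,k)² + Eyˢ(i,j,k)² + Eyˢ(i,j−1,k)² + Ezˢ(i,j,k)² + Ezˢ(i,j,k−1)²]/4 and the face energy fluxes Γx(i,j,k) = −((φⁿ⁺¹ᐟ²(i+1,j,k) + φⁿ⁺¹ᐟ²(i,j,k))/2)·[(Exⁿ⁺¹(i,j,k) − Exⁿ(i,j,k))/Δt + jx(i,j,k)], and analogously Γy, Γz. Then for every (i,j,k): (ℰⁿ⁺¹ − ℰⁿ)(i,j,k)/Δt = (Γx(i,j,k) − Γx(i−1,j,k))/Δx + (Γy(i,j,k) − Γy(i,j−1,k))/Δy + (Γz(i,j,k) − Γz(i,j,k−1))/Δz − (1/2)·[Exⁿ⁺¹ᐟ²(i,j,k)·jx(i,j,k) + Exⁿ⁺¹ᐟ²(i−1,j,k)·jx(i−1,j,k) + Eyⁿ⁺¹ᐟ²(i,j,k)·jy(i,j,k) + Eyⁿ⁺¹ᐟ²(i,j−1,k)·jy(i,j−1,k)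 + Ezⁿ⁺¹ᐟ²(i,j,k)·jz(i,j,k) + Ezⁿ⁺¹ᐟ²(i,j,k−1)·jz(i,j,k−1)]. -/
/-- Multi-dimensional discrete electrostatic-energy local conservation law:
the discrete Ampere divergence law implies that the cell-averaged electric
field energy changes according to an exact discrete flux balance with flux
`Γ_E = −φ_face·((Eⁿ⁺¹ − Eⁿ)/Δt + j̄)` minus the face-averaged `E·j` work. -/
theorem electrostatic_energy_local_conservation_3d
    (Δt Δx Δy Δz : ℝ) (hΔt : 0 < Δt) (hΔx : 0 < Δx) (hΔy : 0 < Δy) (hΔz : 0 < Δz)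
    (φn φn1 jx jy jz : ℤ × ℤ × ℤ → ℝ)
    (Exn Exn1 Eyn Eyn1 Ezn Ezn1 : ℤ × ℤ × ℤ → ℝ)
    (hExn : ∀ i j k : ℤ, Exn (i, j, k) = -(φn (i + 1, j, k) - φn (i, j, k)) / Δx)
    (hExn1 : ∀ i j k : ℤ, Exn1 (i, j, k) = -(φn1 (i + 1, j, k) - φn1 (i, j, k)) / Δx)
    (hEyn : ∀ i j k : ℤ, Eyn (i, j, k) = -(φn (i, j + 1, k) - φn (i, j, k)) / Δy)
    (hEyn1 : ∀ i j k : ℤ, Eyn1 (i, j, k) = -(φn1 (i, j + 1, k) - φn1 (i, j, k)) / Δy)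
    (hEzn : ∀ i j k : ℤ, Ezn (i, j, k) = -(φn (i, j, k + 1) - φn (i, j, k)) / Δz)
    (hEzn1 : ∀ i j k : ℤ, Ezn1 (i, j, k) = -(φn1 (i, j, k + 1) - φn1 (i, j, k)) / Δz)
    (Exh Eyh Ezh φh : ℤ × ℤ × ℤ → ℝ)
    (hExh : ∀ v, Exh v = (Exn v + Exn1 v) / 2)
    (hEyh : ∀ v, Eyh v = (Eyn v + Eyn1 v) / 2)
    (hEzh : ∀ v, Ezh v = (Ezn v + Ezn1 v) / 2)
    (hφh : ∀ v, φh v = (φn v + φn1 v) / 2)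
    (hampere : ∀ i j k : ℤ,
      (((Exn1 (i, j, k) - Exn (i, j, k)) / Δt + jx (i, j, k))
        - ((Exn1 (i - 1, j, k) - Exn (i - 1, j, k)) / Δt + jx (i - 1, j, k))) / Δx
      + (((Eyn1 (i, j, k) - Eyn (i, j, k)) / Δt + jy (i, j, k))
        - ((Eyn1 (i, j - 1, k) - Eyn (i, j - 1, k)) / Δt + jy (i, j - 1, k))) / Δy
      + (((Ezn1 (i, j, k) - Ezn (i, j, k)) / Δt + jz (i, j, k))
        - ((Ezn1 (i, j, k - 1) - Ezn (i, j, k - 1)) / Δt + jz (i, j, k - 1))) / Δz = 0)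
    (ℰn ℰn1 Γx Γy Γz : ℤ × ℤ × ℤ → ℝ)
    (hℰn : ∀ i j k : ℤ, ℰn (i, j, k) =
      ((Exn (i, j, k))^2 + (Exn (i - 1, j, k))^2 + (Eyn (i, j, k))^2
        + (Eyn (i, j - 1, k))^2 + (Ezn (i, j, k))^2 + (Ezn (i, j, k - 1))^2) / 4)
    (hℰn1 : ∀ i j k : ℤ, ℰn1 (i, j, k) =
      ((Exn1 (i, j, k))^2 + (Exn1 (i - 1, j, k))^2 + (Eyn1 (i, j, k))^2
        + (Eyn1 (i, j - 1, k))^2 + (Ezn1 (i, j, k))^2 + (Ezn1 (i, j, k - 1))^2) / 4)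
    (hΓx : ∀ i j k : ℤ, Γx (i, j, k) = -((φh (i + 1, j, k) + φh (i, j, k)) / 2) *
      ((Exn1 (i, j, k) - Exn (i, j, k)) / Δt + jx (i, j, k)))
    (hΓy : ∀ i j k : ℤ, Γy (i, j, k) = -((φh (i, j + 1, k) + φh (i, j, k)) / 2) *
      ((Eyn1 (i, j, k) - Eyn (i, j, k)) / Δt + jy (i, j, k)))
    (hΓz : ∀ i j k : ℤ, Γz (i, j, k) = -((φh (i, j, k + 1) + φh (i, j, k)) / 2) *
      ((Ezn1 (i, j, k) - Ezn (i, j, k)) / Δt + jz (i, j, k))) :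
    ∀ i j k : ℤ,
      (ℰn1 (i, j, k) - ℰn (i, j, k)) / Δt
        = (Γx (i, j, k) - Γx (i - 1, j, k)) / Δx
          + (Γy (i, j, k) - Γy (i, j - 1, k)) / Δy
          + (Γz (i, j, k) - Γz (i, j, k - 1)) / Δz
          - (1/2) * (Exh (i, j, k) * jx (i, j, k) + Exh (i - 1, j, k) * jx (i - 1, j, k)
            + Eyh (i, j, k) * jy (i, j, k) + Eyh (i, j - 1, k) * jy (i, j - 1, k)
            + Ezh (i, j, k) * jz (i, j, k) + Ezh (i, j, k - 1) * jz (i, j, k - 1)) := by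
  intro i j k
  have h := hampere i j k
  simp only [hℰn, hℰn1, hΓx, hΓy, hΓz, hExh, hEyh, hEzh, hφh, hExn, hExn1, hEyn, hEyn1,
    hEzn, hEzn1, sub_add_cancel] at h ⊢
  linear_combination ((φn (i, j, k) + φn1 (i, j, k)) / 2) * h
end

section
/- Let φ : ℝ × ℝ³ → ℝ and A, j : ℝ × ℝ³ → ℝ³ be twice continuously differentiable. Denote by ∇, ∇·, ∇× the spatial gradient, divergence and curl (defined componentwise via partial derivatives), by ∂t the time derivative, and by × the cross product in ℝ³. Suppose that at every point (t, x): the Darwin Ampere law −∂t(∇φ) + j = ∇×(∇×A) holds, and the Coulomb gauge ∇·A = 0 holds. Define E = −∇φ − ∂tA and B = ∇×A. Then at every point (t, x) the local field-energy conservation law holds: ∂t( (1/2)‖∇φ‖² + (1/2)‖B‖² ) + j·E + ∇·( E×B + (∂tφ)(∂tA) ) = 0. -/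
noncomputable section

/-- Time partial derivative `∂t f` of a scalar function on `ℝ × ℝ³`. -/
def pt (f : ℝ × (Fin 3 → ℝ) → ℝ) (p : ℝ × (Fin 3 → ℝ)) : ℝ :=
  fderiv ℝ f p (1, 0)

/-- Spatial partial derivative `∂_i f` of a scalar function on `ℝ × ℝ³`. -/
def px (i : Fin 3) (f : ℝ × (Fin 3 → ℝ) → ℝ) (p : ℝ × (Fin 3 → ℝ)) : ℝ :=
  fderiv ℝ f p (0, Pi.single i 1)

/-- Spatial curl of a vector field on `ℝ × ℝ³`, defined componentwise. -/
def curl (F : ℝ × (Fin 3 → ℝ) → (Fin 3 → ℝ)) (p : ℝ × (Fin 3 → ℝ)) : Fin 3 → ℝ :=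
  ![px 1 (fun q => F q 2) p - px 2 (fun q => F q 1) p,
    px 2 (fun q => F q 0) p - px 0 (fun q => F q 2) p,
    px 0 (fun q => F q 1) p - px 1 (fun q => F q 0) p]

/-- Cross product in `ℝ³`. -/
def cross (u v : Fin 3 → ℝ) : Fin 3 → ℝ :=
  ![u 1 * v 2 - u 2 * v 1, u 2 * v 0 - u 0 * v 2, u 0 * v 1 - u 1 * v 0]

lemma aux_pt_add {f g : ℝ × (Fin 3 → ℝ) → ℝ} (hf : Differentiable ℝ f) (hg : Differentiable ℝ g)
    (p : ℝ × (Fin 3 → ℝ)) (v : ℝ × (Fin 3 → ℝ)) :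
    fderiv ℝ (fun q => f q + g q) p v = fderiv ℝ f p v + fderiv ℝ g p v := by
  rw [fderiv_fun_add (hf p) (hg p)]; rfl

lemma aux_pt_sub {f g : ℝ × (Fin 3 → ℝ) → ℝ} (hf : Differentiable ℝ f) (hg : Differentiable ℝ g)
    (p : ℝ × (Fin 3 → ℝ)) (v : ℝ × (Fin 3 → ℝ)) :
    fderiv ℝ (fun q => f q - g q) p v = fderiv ℝ f p v - fderiv ℝ g p v := by
  rw [fderiv_fun_sub (hf p) (hg p)]; rfl

lemma aux_pt_neg {f : ℝ × (Fin 3 → ℝ) → ℝ}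
    (p : ℝ × (Fin 3 → ℝ)) (v : ℝ × (Fin 3 → ℝ)) :
    fderiv ℝ (fun q => - f q) p v = - fderiv ℝ f p v := by
  rw [fderiv_fun_neg]; rfl

lemma aux_pt_mul {f g : ℝ × (Fin 3 → ℝ) → ℝ} (hf : Differentiable ℝ f) (hg : Differentiable ℝ g)
    (p : ℝ × (Fin 3 → ℝ)) (v : ℝ × (Fin 3 → ℝ)) :
    fderiv ℝ (fun q => f q * g q) p v = f p * fderiv ℝ g p v + g p * fderiv ℝ f p v := by
  rw [fderiv_fun_mul (hf p) (hg p)]; rfl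

lemma aux_pt_const (c : ℝ) (p : ℝ × (Fin 3 → ℝ)) (v : ℝ × (Fin 3 → ℝ)) :
    fderiv ℝ (fun _ : ℝ × (Fin 3 → ℝ) => c) p v = 0 := by
  simp

lemma aux_diff {f : ℝ × (Fin 3 → ℝ) → ℝ} (hf : ContDiff ℝ 2 f) (v : ℝ × (Fin 3 → ℝ)) :
    Differentiable ℝ (fun q => fderiv ℝ f q v) := by
  have h : ContDiff ℝ 1 (fderiv ℝ f) := hf.fderiv_right (by norm_num)
  exact (h.differentiable (by norm_num)).clm_apply (differentiable_const v)

lemma aux_symm {f : ℝ × (Fin 3 → ℝ) → ℝ} (hf : ContDiff ℝ 2 f) (v w p : ℝ × (Fin 3 → ℝ)) :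
    fderiv ℝ (fun q => fderiv ℝ f q v) p w = fderiv ℝ (fun q => fderiv ℝ f q w) p v := by
  have h : ContDiff ℝ 1 (fderiv ℝ f) := hf.fderiv_right (by norm_num)
  have hd : DifferentiableAt ℝ (fderiv ℝ f) p := h.differentiable (by norm_num) p
  have hs : IsSymmSndFDerivAt ℝ f p := hf.contDiffAt.isSymmSndFDerivAt (by simp)
  rw [fderiv_clm_apply hd (differentiableAt_const v),
    fderiv_clm_apply hd (differentiableAt_const w)]
  simpa using hs.eq w v

lemma aux_main (F : Fin 3 → ℝ × (Fin 3 → ℝ) → ℝ) (G : ℝ × (Fin 3 → ℝ) → ℝ)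
    (C : Fin 3 → Fin 3 → ℝ × (Fin 3 → ℝ) → ℝ) (T : Fin 3 → ℝ × (Fin 3 → ℝ) → ℝ)
    (hF : ∀ i, Differentiable ℝ (F i)) (hG : Differentiable ℝ G)
    (hC : ∀ k i, Differentiable ℝ (C k i)) (hT : ∀ i, Differentiable ℝ (T i))
    (j : Fin 3 → ℝ) (p : ℝ × (Fin 3 → ℝ))
    (hFG : ∀ i, px i G p = pt (F i) p)
    (hFF : ∀ i k, px i (F k) p = px k (F i) p)
    (hCT : ∀ k i, px k (T i) p = pt (C k i) p)
    (hdiv : ∀ q, C 0 0 q + C 1 1 q + C 2 2 q = 0)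
    (h0 : -(pt (F 0) p) + j 0 = px 1 (fun q => C 0 1 q - C 1 0 q) p
      - px 2 (fun q => C 2 0 q - C 0 2 q) p)
    (h1 : -(pt (F 1) p) + j 1 = px 2 (fun q => C 1 2 q - C 2 1 q) p
      - px 0 (fun q => C 0 1 q - C 1 0 q) p)
    (h2 : -(pt (F 2) p) + j 2 = px 0 (fun q => C 2 0 q - C 0 2 q) p
      - px 1 (fun q => C 1 2 q - C 2 1 q) p) :
    pt (fun q => (1/2) * (F 0 q * F 0 q + F 1 q * F 1 q + F 2 q * F 2 q)
      + (1/2) * ((C 1 2 q - C 2 1 q) * (C 1 2 q - C 2 1 q)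
        + (C 2 0 q - C 0 2 q) * (C 2 0 q - C 0 2 q)
        + (C 0 1 q - C 1 0 q) * (C 0 1 q - C 1 0 q))) p
    + (j 0 * (-(F 0 p) - T 0 p) + j 1 * (-(F 1 p) - T 1 p) + j 2 * (-(F 2 p) - T 2 p))
    + (px 0 (fun q => ((-(F 1 q) - T 1 q) * (C 0 1 q - C 1 0 q)
          - (-(F 2 q) - T 2 q) * (C 2 0 q - C 0 2 q)) + G q * T 0 q) p
      + px 1 (fun q => ((-(F 2 q) - T 2 q) * (C 1 2 q - C 2 1 q)
          - (-(F 0 q) - T 0 q) * (C 0 1 q - C 1 0 q)) + G q * T 1 q) p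
      + px 2 (fun q => ((-(F 0 q) - T 0 q) * (C 2 0 q - C 0 2 q)
          - (-(F 1 q) - T 1 q) * (C 1 2 q - C 2 1 q)) + G q * T 2 q) p)
    = 0 := by
  have hd : pt (C 0 0) p + pt (C 1 1) p + pt (C 2 2) p = 0 := by
    have h : (fun q => C 0 0 q + C 1 1 q + C 2 2 q) = fun _ => (0 : ℝ) := funext hdiv
    have h' := congrArg (fun f => pt f p) h
    simpa (discharger := fun_prop) only [pt, aux_pt_add, aux_pt_const] using h'
  have e01 := hFF 0 1
  have e02 := hFF 0 2
  have e12 := hFF 1 2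
  have g0 := hFG 0
  have g1 := hFG 1
  have g2 := hFG 2
  have c00 := hCT 0 0
  have c01 := hCT 0 1
  have c02 := hCT 0 2
  have c10 := hCT 1 0
  have c11 := hCT 1 1
  have c12 := hCT 1 2
  have c20 := hCT 2 0
  have c21 := hCT 2 1
  have c22 := hCT 2 2
  clear hFF hFG hCT
  simp (discharger := fun_prop) only [pt, px, aux_pt_add, aux_pt_sub, aux_pt_neg, aux_pt_mul,
    aux_pt_const] at *
  rw [c00, c01, c02, c10, c11, c12, c20, c21, c22, g0, g1, g2, e01, e02, e12]
  linear_combination (-(F 0 p) - T 0 p) * h0 + (-(F 1 p) - T 1 p) * h1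
    + (-(F 2 p) - T 2 p) * h2 + G p * hd

/-- Continuum local field-energy conservation law of the Vlasov–Darwin model:
under the Darwin Ampere law `−∂t(∇φ) + j = ∇×(∇×A)` and the Coulomb gauge
`∇·A = 0`, with `E = −∇φ − ∂tA` and `B = ∇×A`, one has
`∂t(½‖∇φ‖² + ½‖B‖²) + j·E + ∇·(E×B + ∂tφ ∂tA) = 0` everywhere. -/
theorem darwin_field_energy_local_conservation
    (φ : ℝ × (Fin 3 → ℝ) → ℝ) (A j : ℝ × (Fin 3 → ℝ) → (Fin 3 → ℝ))
    (hφ : ContDiff ℝ 2 φ) (hA : ContDiff ℝ 2 A) (hj : ContDiff ℝ 2 j)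
    (hampere : ∀ (p : ℝ × (Fin 3 → ℝ)) (i : Fin 3),
      -(pt (fun q => px i φ q) p) + j p i = curl (fun q => curl A q) p i)
    (hcoulomb : ∀ p : ℝ × (Fin 3 → ℝ), (∑ i : Fin 3, px i (fun q => A q i) p) = 0)
    (E B : ℝ × (Fin 3 → ℝ) → (Fin 3 → ℝ))
    (hE : ∀ p i, E p i = -(px i φ p) - pt (fun q => A q i) p)
    (hB : ∀ p, B p = curl A p) :
    ∀ p : ℝ × (Fin 3 → ℝ),
      pt (fun q => (1/2) * (∑ i : Fin 3, (px i φ q)^2)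
          + (1/2) * (∑ i : Fin 3, (B q i)^2)) p
      + (∑ i : Fin 3, j p i * E p i)
      + (∑ i : Fin 3, px i (fun q =>
          cross (E q) (B q) i + pt φ q * pt (fun r => A r i) q) p)
      = 0 := by
  intro p
  have hAi : ∀ i, ContDiff ℝ 2 (fun q => A q i) := fun i => contDiff_pi.1 hA i
  have hEe : ∀ q i, E q i = -(px i φ q) - pt (fun q => A q i) q := hE
  have key := aux_main (fun i q => px i φ q) (pt φ) (fun k i q => px k (fun r => A r i) q)
    (fun i q => pt (fun r => A r i) q)
    (fun i => aux_diff hφ _) (aux_diff hφ _) (fun k i => aux_diff (hAi i) _)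
    (fun i => aux_diff (hAi i) _) (j p) p
    (fun i => aux_symm hφ _ _ p) (fun i k => aux_symm hφ _ _ p)
    (fun k i => aux_symm (hAi i) _ _ p)
    (fun q => by simpa [Fin.sum_univ_three] using hcoulomb q)
    (hampere p 0) (hampere p 1) (hampere p 2)
  simp only [Fin.sum_univ_three, hE, hB, cross, pow_two]
  exact key
end
end

section
/- Let N be a positive natural number and fix Δt, Δx > 0. Let φ, Eⁿ, Eⁿ⁺¹, j : ZMod N → ℝ, and set Eⁿ⁺¹ᐟ²(i) = (Eⁿ(i) + Eⁿ⁺¹(i))/2 and ⟨j⟩ = (1/N)·Σ_{i} j(i). Suppose Eⁿ⁺¹ᐟ²(i) = −(φ(i+1) − φ(i))/Δx for all i, and the discrete Ampere law (Eⁿ⁺¹(i) − Eⁿ(i))/Δt + j(i) = ⟨j⟩ holds for all i. Define ℰˢ(i) = ((Eˢ(i))² + (Eˢ(i−1))²)/4 for s ∈ {n, n+1} and Γ_E(i) = −⟨j⟩·(φ(i+1) + φ(i))/2. Then for every i ∈ ZMod N: (ℰⁿ⁺¹(i) − ℰⁿ(i))/Δt + (1/2)·(Eⁿ⁺¹ᐟ²(i)·j(i)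 + Eⁿ⁺¹ᐟ²(i−1)·j(i−1)) = (Γ_E(i) − Γ_E(i−1))/Δx. -/
/-- 1D discrete electric-field energy local conservation law on a periodic
mesh of `N` cells, with the mesh-averaged current `⟨j⟩` source put in exact
conservative form via the flux `Γ_E(i) = −⟨j⟩·(φ(i+1) + φ(i))/2`. -/
theorem periodic_field_energy_local_conservation
    (N : ℕ) [NeZero N] (Δt Δx : ℝ) (hΔt : 0 < Δt) (hΔx : 0 < Δx)
    (φ En En1 j : ZMod N → ℝ)
    (Eh : ZMod N → ℝ) (hEh : ∀ i, Eh i = (En i + En1 i) / 2)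
    (javg : ℝ) (hjavg : javg = (1 / (N : ℝ)) * ∑ i, j i)
    (hfield : ∀ i, Eh i = -(φ (i + 1) - φ i) / Δx)
    (hampere : ∀ i, (En1 i - En i) / Δt + j i = javg) :
    ∀ i : ZMod N,
      ((((En1 i)^2 + (En1 (i - 1))^2) / 4 - ((En i)^2 + (En (i - 1))^2) / 4)) / Δt
        + (1/2) * (Eh i * j i + Eh (i - 1) * j (i - 1))
      = ((-javg * ((φ (i + 1) + φ i) / 2)) - (-javg * ((φ i + φ (i - 1)) / 2))) / Δx := by
  intro i
  have f1 := hfield i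
  have f2 := hfield (i - 1)
  rw [sub_add_cancel] at f2
  linear_combination (Eh i / 2) * hampere i + (Eh (i - 1) / 2) * hampere (i - 1)
    - ((En1 i - En i) / Δt / 2) * hEh i
    - ((En1 (i - 1) - En (i - 1)) / Δt / 2) * hEh (i - 1)
    + (javg / 2) * f1 + (javg / 2) * f2
end
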